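/- Let x ∈ (a,b) be fixed and let h = h(n) → 0 with n h³ → 0. Then n·h · [ h^{−1} ∫_a^b K((x−y)/h) d𝔽_{c_n}(y) − f_{c_n}(x) ] → 0 as n → ∞; in particular the remainder after replacing f_{c_n}(x−yh) by its second-order Taylor expansion is bounded by 4 n h³ ((x−a)^{−2} + (b−x)^{−2}) (‖f‖ + M) ∫ y² |K(y)| dy for a constant M. -/

import Mathlib

open MeasureTheory Filter Topology

noncomputable section

/-- Left edge `a = (1 − √c)²` of the Marcenko–Pastur law. -/
def mpA (c : ℝ) : ℝ := (1 - Real.sqrt c) ^ 2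

/-- Right edge `b = (1 + √c)²` of the Marcenko–Pastur law. -/
def mpB (c : ℝ) : ℝ := (1 + Real.sqrt c) ^ 2

/-- Density of the Marcenko–Pastur law with parameter `c`. -/
def mpDensity (c x : ℝ) : ℝ :=
  if mpA c ≤ x ∧ x ≤ mpB c then
    Real.sqrt ((mpB c - x) * (x - mpA c)) / (2 * Real.pi * c * x)
  else 0

/-- First-order Taylor expansion of a `C²` function, with a quadratic remainder that is uniform
in the base point. -/
lemma ContDiffAt.exists_uniform_taylor_bound {E : Type*} [NormedAddCommGroup E] [NormedSpace ℝ E]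
    {F : E → ℝ} {z₀ : E} (hF : ContDiffAt ℝ 2 F z₀) :
    ∃ L D δ : ℝ, 0 ≤ L ∧ 0 ≤ D ∧ 0 < δ ∧ ∀ z ∈ Metric.ball z₀ δ, ‖fderiv ℝ F z‖ ≤ D ∧
      ∀ z' ∈ Metric.ball z₀ δ, ‖F z' - F z - fderiv ℝ F z (z' - z)‖ ≤ L * ‖z' - z‖ ^ 2 := by
  have hF' : ContDiffAt ℝ 1 (fderiv ℝ F) z₀ := hF.fderiv_right (by norm_num)
  obtain ⟨L, t, ht, hL⟩ := hF'.exists_lipschitzOnWith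
  have hdiff : ∀ᶠ z in 𝓝 z₀, DifferentiableAt ℝ F z :=
    (hF.eventually (by simp)).mono fun z hz => hz.differentiableAt (by norm_num)
  have hbound : ∀ᶠ z in 𝓝 z₀, ‖fderiv ℝ F z‖ < ‖fderiv ℝ F z₀‖ + 1 :=
    hF'.continuousAt.norm.eventually_lt continuousAt_const (by simp)
  obtain ⟨δ, hδ, hball⟩ := Metric.eventually_nhds_iff_ball.1 (hdiff.and (hbound.and ht))
  refine ⟨L, ‖fderiv ℝ F z₀‖ + 1, δ, L.2, by positivity, hδ, fun z hz =>
    ⟨(hball z hz).2.1.le, fun z' hz' => ?_⟩⟩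
  have hseg : segment ℝ z z' ⊆ Metric.ball z₀ δ := (convex_ball z₀ δ).segment_subset hz hz'
  have hmvt := (convex_segment z z').norm_image_sub_le_of_norm_fderiv_le'
    (f := F) (φ := fderiv ℝ F z) (C := L * ‖z' - z‖)
    (fun w hw => (hball w (hseg hw)).1) (fun w hw => ?_)
    (left_mem_segment ℝ z z') (right_mem_segment ℝ z z')
  · simpa [pow_two, mul_assoc] using hmvt
  · have h₁ := hL.dist_le_mul w (hball w (hseg hw)).2.2 z (hball z hz).2.2
    rw [dist_eq_norm, dist_eq_norm] at h₁
    exact h₁.trans (mul_le_mul_of_nonneg_left (norm_sub_le_of_mem_segment hw) L.2)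

/-- The bias of a kernel smoother of order one is quadratic in the bandwidth. -/
lemma abs_kernel_smoother_sub_le {K φ : ℝ → ℝ} (hKint : Integrable K) (hKone : ∫ y : ℝ, K y = 1)
    (hxK : Integrable (fun y : ℝ => y * K y)) (hxKzero : ∫ y : ℝ, y * K y = 0)
    (hx2K : Integrable (fun y : ℝ => y ^ 2 * |K y|)) (hφ : Measurable φ)
    {l r x d C h : ℝ} (hl : l < x) (hr : x < r) (hh : 0 < h)
    (hin : ∀ y ∈ Set.Ioc l r, |φ y - φ x - d * (y - x)| ≤ C * (y - x) ^ 2)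
    (hout : ∀ y ∉ Set.Ioc l r, |φ x + d * (y - x)| ≤ C * (y - x) ^ 2) :
    |h⁻¹ * (∫ y in l..r, K ((x - y) / h) * φ y) - φ x|
      ≤ C * h ^ 2 * ∫ y : ℝ, y ^ 2 * |K y| := by
  set g : ℝ → ℝ := (Set.Ioc l r).indicator φ with hg
  have hgm : Measurable g := hφ.indicator measurableSet_Ioc
  have hgb : ∀ y, |g y - φ x - d * (y - x)| ≤ C * (y - x) ^ 2 := fun y => by
    by_cases hy : y ∈ Set.Ioc l r
    · simpa [hg, hy] using hin y hy
    · have := hout y hy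
      rw [← abs_neg] at this
      rw [hg, Set.indicator_of_notMem hy]
      convert this using 2
      ring
  have hsub : h⁻¹ * (∫ y in l..r, K ((x - y) / h) * φ y) = ∫ u, K u * g (x - h * u) := by
    have h₁ : ∫ y in l..r, K ((x - y) / h) * φ y
        = ∫ y, (fun u => K u * g (x - h * u)) ((x - y) / h) := by
      rw [intervalIntegral.integral_of_le (hl.trans hr).le,
        ← integral_indicator measurableSet_Ioc]
      congr 1 with y
      have : x - h * ((x - y) / h) = y := by field_simp; ring
      simp only [this, hg]
      by_cases hy : y ∈ Set.Ioc l r <;> simp [hy]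
    rw [h₁, integral_sub_left_eq_self (fun t => (fun u => K u * g (x - h * u)) (t / h)) volume x,
      Measure.integral_comp_div (fun u => K u * g (x - h * u)), abs_of_pos hh, smul_eq_mul,
      inv_mul_cancel_left₀ hh.ne']
  have hRb : ∀ u, ‖K u * (g (x - h * u) - φ x - d * (x - h * u - x))‖
      ≤ C * h ^ 2 * (u ^ 2 * |K u|) := fun u => by
    rw [norm_mul, Real.norm_eq_abs, Real.norm_eq_abs]
    calc _ ≤ |K u| * (C * (x - h * u - x) ^ 2) :=
          mul_le_mul_of_nonneg_left (hgb _) (abs_nonneg _)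
      _ = _ := by ring
  have hRint : Integrable (fun u => K u * (g (x - h * u) - φ x - d * (x - h * u - x))) :=
    (hx2K.const_mul (C * h ^ 2)).mono'
      (hKint.aestronglyMeasurable.mul (by fun_prop : Measurable _).aestronglyMeasurable)
      (.of_forall hRb)
  have hsum : ∫ u, K u * g (x - h * u)
      = (∫ u, K u * (g (x - h * u) - φ x - d * (x - h * u - x))) + φ x := by
    have h₁ : (fun u => K u * g (x - h * u)) = fun u =>
        K u * (g (x - h * u) - φ x - d * (x - h * u - x)) + (φ x * K u - d * h * (u * K u)) := by
      ext u; ring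
    have hlin : Integrable (fun u => φ x * K u - d * h * (u * K u)) :=
      (hKint.const_mul _).sub (hxK.const_mul _)
    rw [h₁, integral_add hRint hlin, integral_sub (hKint.const_mul _) (hxK.const_mul _), integral_const_mul,
      integral_const_mul, hKone, hxKzero]
    ring
  rw [hsub, hsum, add_sub_cancel_right, ← Real.norm_eq_abs, ← integral_const_mul]
  exact norm_integral_le_of_norm_le (hx2K.const_mul _) (.of_forall hRb)

lemma mpA_le_mpB (c : ℝ) : mpA c ≤ mpB c := by
  unfold mpA mpB
  nlinarith [Real.sqrt_nonneg c]

/-- The truncation in the density is automatic, as the root of a negative number is zero. -/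
lemma mpDensity_eq (c x : ℝ) :
    mpDensity c x = Real.sqrt ((mpB c - x) * (x - mpA c)) / (2 * Real.pi * c * x) := by
  unfold mpDensity
  split_ifs with hx
  · rfl
  · have hAB := mpA_le_mpB c
    rw [Real.sqrt_eq_zero_of_nonpos, zero_div]
    by_cases h₁ : mpA c ≤ x
    · have h₂ : mpB c < x := not_le.1 fun h₂ => hx ⟨h₁, h₂⟩
      exact mul_nonpos_of_nonpos_of_nonneg (by linarith) (by linarith)
    · exact mul_nonpos_of_nonneg_of_nonpos (by linarith) (by linarith)

lemma mpA_pos {c : ℝ} (hc : c ∈ Set.Ioo (0 : ℝ) 1) : 0 < mpA c := by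
  have h₁ : Real.sqrt c < 1 := by simpa using Real.sqrt_lt_sqrt hc.1.le hc.2
  unfold mpA
  have : 0 < 1 - Real.sqrt c := by linarith
  positivity

lemma measurable_mpDensity (c : ℝ) : Measurable (mpDensity c) := by
  rw [funext (mpDensity_eq c)]
  fun_prop

lemma contDiffAt_mpDensity {c x : ℝ} (hc : c ∈ Set.Ioo (0 : ℝ) 1)
    (hx : x ∈ Set.Ioo (mpA c) (mpB c)) :
    ContDiffAt ℝ 2 (fun z : ℝ × ℝ => mpDensity z.1 z.2) (c, x) := by
  have hx0 : 0 < x := (mpA_pos hc).trans hx.1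
  have hq : (mpB c - x) * (x - mpA c) ≠ 0 :=
    (mul_pos (sub_pos.2 hx.2) (sub_pos.2 hx.1)).ne'
  have hs : ContDiffAt ℝ 2 (fun z : ℝ × ℝ => Real.sqrt z.1) (c, x) :=
    contDiffAt_fst.sqrt hc.1.ne'
  have hy : ContDiffAt ℝ 2 (fun z : ℝ × ℝ => z.2) (c, x) := contDiffAt_snd
  have hc' : ContDiffAt ℝ 2 (fun z : ℝ × ℝ => z.1) (c, x) := contDiffAt_fst
  simp only [mpDensity_eq]
  refine ContDiffAt.div (ContDiffAt.sqrt ?_ hq) ((contDiffAt_const.mul hc').mul hy)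
    (by have := hc.1; positivity)
  exact (((contDiffAt_const.add hs).pow 2).sub hy).mul
    (hy.sub ((contDiffAt_const.sub hs).pow 2))

lemma exists_mpDensity_bound {c : ℝ} (hc : c ∈ Set.Ioo (0 : ℝ) 1) :
    ∃ B, ∀ᶠ c' in 𝓝 c, ∀ y ∈ Set.Icc (mpA c) (mpB c), |mpDensity c' y| ≤ B := by
  have hcont : ContinuousOn (fun z : ℝ × ℝ => mpDensity z.1 z.2)
      (Set.Icc (c / 2) (2 * c) ×ˢ Set.Icc (mpA c) (mpB c)) := by
    simp only [mpDensity_eq]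
    refine ContinuousOn.div (by unfold mpA mpB; fun_prop) (by fun_prop) fun z hz => ?_
    have h₁ : 0 < z.1 := (half_pos hc.1).trans_le hz.1.1
    have h₂ : 0 < z.2 := (mpA_pos hc).trans_le hz.2.1
    positivity
  obtain ⟨B, hB⟩ := (isCompact_Icc.prod isCompact_Icc).exists_bound_of_continuousOn hcont
  refine ⟨B, ?_⟩
  filter_upwards [Icc_mem_nhds (half_lt_self hc.1) (by linarith [hc.1] : c < 2 * c)]
    with c' hc' y hy
  exact hB (c', y) ⟨hc', hy⟩

/-- A bounded quantity plus a linear one is dominated by a square away from the origin. -/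
lemma add_mul_abs_le_mul_sq {B D δ t : ℝ} (hB : 0 ≤ B) (hD : 0 ≤ D) (hδ : 0 < δ) (ht : δ ≤ |t|) :
    B + D * |t| ≤ (B / δ ^ 2 + D / δ) * t ^ 2 := by
  have h₁ : 1 ≤ |t| / δ := (one_le_div hδ).2 ht
  have h₂ : |t| / δ ≤ (|t| / δ) ^ 2 := by nlinarith
  calc B + D * |t| ≤ B * (|t| / δ) ^ 2 + D * |t| * (|t| / δ) := by
        have := mul_le_mul_of_nonneg_left (h₁.trans h₂) hB
        have := mul_le_mul_of_nonneg_left h₁ (mul_nonneg hD (abs_nonneg t))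
        linarith
    _ = (B / δ ^ 2 + D / δ) * |t| ^ 2 := by field_simp
    _ = _ := by rw [sq_abs]

/-- Quadratic Taylor remainder for the Marcenko–Pastur density, uniform in the parameter. -/
lemma exists_mpDensity_taylor_bound {c x : ℝ} (hc : c ∈ Set.Ioo (0 : ℝ) 1)
    (hx : x ∈ Set.Ioo (mpA c) (mpB c)) :
    ∃ C B, ∀ᶠ c' in 𝓝 c, |mpDensity c' x| ≤ B ∧ ∃ d,
      (∀ y ∈ Set.Ioc (mpA c) (mpB c),
        |mpDensity c' y - mpDensity c' x - d * (y - x)| ≤ C * (y - x) ^ 2) ∧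
      ∀ y ∉ Set.Ioc (mpA c) (mpB c), |mpDensity c' x + d * (y - x)| ≤ C * (y - x) ^ 2 := by
  obtain ⟨L, D, δ₀, hL, hD, hδ₀, hT⟩ := (contDiffAt_mpDensity hc hx).exists_uniform_taylor_bound
  obtain ⟨B, hB⟩ := exists_mpDensity_bound hc
  have hB0 : 0 ≤ B := (abs_nonneg _).trans (hB.self_of_nhds x ⟨hx.1.le, hx.2.le⟩)
  obtain ⟨δ, hδ, hδδ₀, hδa, hδb⟩ : ∃ δ > 0, δ ≤ δ₀ ∧ δ ≤ x - mpA c ∧ δ ≤ mpB c - x :=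
    ⟨min δ₀ (min (x - mpA c) (mpB c - x)),
      lt_min hδ₀ (lt_min (sub_pos.2 hx.1) (sub_pos.2 hx.2)), min_le_left _ _,
      (min_le_right _ _).trans (min_le_left _ _), (min_le_right _ _).trans (min_le_right _ _)⟩
  refine ⟨L + (2 * B / δ ^ 2 + D / δ), B, ?_⟩
  filter_upwards [hB, Metric.ball_mem_nhds c hδ₀] with c' hB' hc'
  have hBx := hB' x ⟨hx.1.le, hx.2.le⟩
  have hz : (c', x) ∈ Metric.ball (c, x) δ₀ := by
    simpa [Prod.dist_eq, hδ₀] using hc'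
  obtain ⟨hDz, hTz⟩ := hT _ hz
  set A := fderiv ℝ (fun z : ℝ × ℝ => mpDensity z.1 z.2) (c', x)
  have hA : ∀ t : ℝ, A (0, t) = A (0, 1) * t := fun t => by
    have : ((0 : ℝ), t) = t • ((0 : ℝ), (1 : ℝ)) := by simp
    rw [this, map_smul, smul_eq_mul, mul_comm]
  have hd : |A (0, 1)| ≤ D := by
    have := (A.le_opNorm (0, 1)).trans (mul_le_mul_of_nonneg_right hDz (norm_nonneg _))
    simpa [Prod.norm_def] using this
  have hlin : ∀ t : ℝ, |A (0, 1) * t| ≤ D * |t| := fun t => by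
    rw [abs_mul]
    exact mul_le_mul_of_nonneg_right hd (abs_nonneg _)
  have hfar : ∀ y, δ ≤ |y - x| →
      2 * B + D * |y - x| ≤ (L + (2 * B / δ ^ 2 + D / δ)) * (y - x) ^ 2 := fun y hy => by
    have h₁ := add_mul_abs_le_mul_sq (by positivity : 0 ≤ 2 * B) hD hδ hy
    have h₂ := mul_nonneg hL (sq_nonneg (y - x))
    linarith
  refine ⟨hBx, A (0, 1), fun y hy => ?_, fun y hy => ?_⟩
  · by_cases hyx : |y - x| < δ
    · have hz' : (c', y) ∈ Metric.ball (c, x) δ₀ := by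
        rw [Metric.mem_ball, Prod.dist_eq]
        exact max_lt hc' (by rw [Real.dist_eq]; linarith)
      have h₁ := hTz _ hz'
      have hnorm : ‖((0 : ℝ), y - x)‖ = |y - x| := by simp [Prod.norm_def]
      rw [Prod.mk_sub_mk, sub_self, hA, hnorm, Real.norm_eq_abs, sq_abs] at h₁
      have : 0 ≤ (2 * B / δ ^ 2 + D / δ) * (y - x) ^ 2 := by positivity
      linarith
    · refine le_trans ?_ (hfar y (not_lt.1 hyx))
      have h₁ := hB' y ⟨hy.1.le, hy.2⟩
      have h₂ := abs_sub (mpDensity c' y - mpDensity c' x) (A (0, 1) * (y - x))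
      have h₃ := abs_sub (mpDensity c' y) (mpDensity c' x)
      linarith [hlin (y - x)]
  · refine le_trans ?_ (hfar y ?_)
    · linarith [abs_add_le (mpDensity c' x) (A (0, 1) * (y - x)), hlin (y - x)]
    · by_cases h₁ : mpA c < y
      · have h₂ : mpB c < y := not_le.1 fun h₂ => hy ⟨h₁, h₂⟩
        exact le_trans (by linarith) (le_abs_self _)
      · exact le_trans (by linarith) (neg_le_abs _)

/-- Chebyshev-type bound for the mass that a kernel puts outside an interval around zero. -/
lemma abs_integral_kernel_sub_one_le {K : ℝ → ℝ} (hKint : Integrable K)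
    (hKone : ∫ y : ℝ, K y = 1) (hxK : Integrable (fun y : ℝ => y * K y))
    (hxKzero : ∫ y : ℝ, y * K y = 0) (hx2K : Integrable (fun y : ℝ => y ^ 2 * |K y|))
    {a b x δ h : ℝ} (hδ : 0 < δ) (ha : 2 * δ ≤ x - a) (hb : 2 * δ ≤ b - x) (hh : 0 < h) :
    |(∫ y in (x - b) / (2 * h)..(x - a) / (2 * h), K y) - 1|
      ≤ (δ ^ 2)⁻¹ * h ^ 2 * ∫ y : ℝ, y ^ 2 * |K y| := by
  have hout : ∀ y ∉ Set.Ioc ((x + a) / 2) ((x + b) / 2), 1 ≤ (δ ^ 2)⁻¹ * (y - x) ^ 2 := by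
    intro y hy
    rw [← div_eq_inv_mul, one_le_div (by positivity), ← sq_abs (y - x)]
    refine pow_le_pow_left₀ hδ.le ?_ 2
    by_cases h₁ : (x + a) / 2 < y
    · have h₂ : (x + b) / 2 < y := not_le.1 fun h₂ => hy ⟨h₁, h₂⟩
      exact le_trans (by linarith) (le_abs_self _)
    · exact le_trans (by linarith) (neg_le_abs _)
  have key := abs_kernel_smoother_sub_le (φ := fun _ => 1) (d := 0) (C := (δ ^ 2)⁻¹)
    (l := (x + a) / 2) (r := (x + b) / 2) (x := x) (h := h) hKint hKone hxK hxKzero hx2K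
    measurable_const (by linarith) (by linarith) hh
    (fun y _ => by simp only [sub_self, zero_mul, abs_zero]; positivity)
    (fun y hy => by simpa using hout y hy)
  simp only [mul_one, sub_div x] at key
  rw [intervalIntegral.integral_comp_sub_div K hh.ne', smul_eq_mul,
    inv_mul_cancel_left₀ hh.ne'] at key
  convert key using 5 <;> field_simp <;> ring

lemma integral_sq_mul_abs_pos {K : ℝ → ℝ} (hKone : ∫ y : ℝ, K y = 1)
    (hx2K : Integrable (fun y : ℝ => y ^ 2 * |K y|)) : 0 < ∫ y : ℝ, y ^ 2 * |K y| := by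
  have hnn : 0 ≤ fun y : ℝ => y ^ 2 * |K y| := fun y => by positivity
  refine (integral_nonneg hnn).lt_of_ne' fun h0 => ?_
  have hK0 : K =ᵐ[volume] 0 := by
    filter_upwards [(integral_eq_zero_iff_of_nonneg hnn hx2K).1 h0,
      compl_mem_ae_iff.2 (measure_singleton (0 : ℝ))] with y hy hy0
    have hy0' : y ≠ 0 := hy0
    simpa [hy0'] using hy
  rw [integral_congr_ae hK0] at hKone
  simp at hKone

/-- An eventual bound by a positive sequence extends to all indices after enlarging the
constant. -/
lemma exists_forall_le_mul_of_eventually {u v : ℕ → ℝ} {C : ℝ} (hv : ∀ n, 0 ≤ v n)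
    (huv : ∀ n, v n = 0 → u n ≤ 0) (hev : ∀ᶠ n in atTop, u n ≤ C * v n) :
    ∃ M > (0 : ℝ), ∀ n, u n ≤ M * v n := by
  obtain ⟨N, hN⟩ := eventually_atTop.1 hev
  have hS : 0 ≤ ∑ i ∈ Finset.range N, |u i / v i| := Finset.sum_nonneg fun i _ => abs_nonneg _
  refine ⟨|C| + 1 + ∑ i ∈ Finset.range N, |u i / v i|, by positivity, fun n => ?_⟩
  rcases lt_or_ge n N with hn | hn
  · rcases (hv n).eq_or_lt' with h0 | hpos
    · simpa [h0] using huv n h0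
    · rw [← div_le_iff₀ hpos]
      have h₁ := Finset.single_le_sum (f := fun i => |u i / v i|) (fun i _ => abs_nonneg _)
        (Finset.mem_range.2 hn)
      linarith [le_abs_self (u n / v n), abs_nonneg C]
  · refine (hN n hn).trans (mul_le_mul_of_nonneg_right ?_ (hv n))
    linarith [le_abs_self C]

/-- **Bias lemma** (proof of Theorem 2.4 of the paper): for fixed `x ∈ (a,b)` and
`h = h(n) → 0` with `n h³ → 0`,
`n h [ h⁻¹ ∫_a^b K((x−y)/h) d𝔽_{c_n}(y) − f_{c_n}(x) ] → 0`; moreover the remainder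
after replacing the integral by `f_{c_n}(x) ∫_{(x−b)/(2h)}^{(x−a)/(2h)} K(y) dy` is bounded
by `4 n h³ ((x−a)⁻² + (b−x)⁻²)(‖f‖ + M) ∫ y²|K(y)| dy` for some constant `M`. -/
theorem kernel_bias_lemma
    (c : ℝ) (hc : c ∈ Set.Ioo (0 : ℝ) 1)
    (p : ℕ → ℕ) (hp : Tendsto (fun n => (p n : ℝ) / n) atTop (𝓝 c))
    (hsmooth : ∀ n, ContDiffOn ℝ 2 (mpDensity ((p n : ℝ) / n)) (Set.Ioo (mpA c) (mpB c)))
    (K : ℝ → ℝ) (hKint : Integrable K) (hKone : ∫ y : ℝ, K y = 1)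
    (hxK : Integrable (fun y : ℝ => y * K y)) (hxKzero : ∫ y : ℝ, y * K y = 0)
    (hx2K : Integrable (fun y : ℝ => y ^ 2 * |K y|))
    (h : ℕ → ℝ) (hhpos : ∀ n, 0 < h n) (hh0 : Tendsto h atTop (𝓝 0))
    (hnh3 : Tendsto (fun n : ℕ => (n : ℝ) * h n ^ 3) atTop (𝓝 0))
    (x : ℝ) (hx : x ∈ Set.Ioo (mpA c) (mpB c)) :
    Tendsto (fun n : ℕ => (n : ℝ) * h n *
        ((h n)⁻¹ * (∫ y in mpA c..mpB c, K ((x - y) / h n) * mpDensity ((p n : ℝ) / n) y)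
          - mpDensity ((p n : ℝ) / n) x)) atTop (𝓝 0)
    ∧ ∃ M > (0 : ℝ), ∀ n : ℕ,
        |(n : ℝ) * h n *
            ((h n)⁻¹ * (∫ y in mpA c..mpB c, K ((x - y) / h n) * mpDensity ((p n : ℝ) / n) y)
              - mpDensity ((p n : ℝ) / n) x)
          - (n : ℝ) * h n *
            (mpDensity ((p n : ℝ) / n) x *
                (∫ y in (x - mpB c) / (2 * h n)..(x - mpA c) / (2 * h n), K y)
              - mpDensity ((p n : ℝ) / n) x)|
          ≤ 4 * n * h n ^ 3 * ((x - mpA c)⁻¹ ^ 2 + (mpB c - x)⁻¹ ^ 2)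
            * ((⨆ y : ℝ, mpDensity ((p n : ℝ) / n) y) + M)
            * ∫ y : ℝ, y ^ 2 * |K y| := by
  set κ : ℝ := ∫ y : ℝ, y ^ 2 * |K y| with hκ
  have hκpos : 0 < κ := integral_sq_mul_abs_pos hKone hx2K
  obtain ⟨C, B, hCB⟩ := exists_mpDensity_taylor_bound hc hx
  obtain ⟨δ, hδ, hδa, hδb⟩ : ∃ δ > 0, 2 * δ ≤ x - mpA c ∧ 2 * δ ≤ mpB c - x :=
    ⟨min (x - mpA c) (mpB c - x) / 2,
      half_pos (lt_min (sub_pos.2 hx.1) (sub_pos.2 hx.2)),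
      by linarith [min_le_left (x - mpA c) (mpB c - x)],
      by linarith [min_le_right (x - mpA c) (mpB c - x)]⟩
  set f : ℕ → ℝ := fun n => mpDensity ((p n : ℝ) / n) x
  set I : ℕ → ℝ := fun n =>
    (h n)⁻¹ * (∫ y in mpA c..mpB c, K ((x - y) / h n) * mpDensity ((p n : ℝ) / n) y)
  set J : ℕ → ℝ := fun n =>
    ∫ y in (x - mpB c) / (2 * h n)..(x - mpA c) / (2 * h n), K y
  have hIf : ∀ᶠ n in atTop, |I n - f n| ≤ C * h n ^ 2 * κ := by
    filter_upwards [hp.eventually hCB] with n hn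
    obtain ⟨-, d, hin, hout⟩ := hn
    exact abs_kernel_smoother_sub_le hKint hKone hxK hxKzero hx2K (measurable_mpDensity _)
      hx.1 hx.2 (hhpos n) hin hout
  have hJ1 : ∀ n, |J n - 1| ≤ (δ ^ 2)⁻¹ * h n ^ 2 * κ := fun n =>
    abs_integral_kernel_sub_one_le hKint hKone hxK hxKzero hx2K hδ hδa hδb (hhpos n)
  have hnh : ∀ n : ℕ, 0 ≤ (n : ℝ) * h n := fun n => mul_nonneg n.cast_nonneg (hhpos n).le
  refine ⟨?_, ?_⟩
  · refine squeeze_zero_norm' (a := fun n : ℕ => C * κ * ((n : ℝ) * h n ^ 3)) ?_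
      (by simpa using hnh3.const_mul (C * κ))
    filter_upwards [hIf] with n hn
    rw [norm_mul, Real.norm_of_nonneg (hnh n), Real.norm_eq_abs]
    calc (n : ℝ) * h n * |I n - f n| ≤ (n : ℝ) * h n * (C * h n ^ 2 * κ) :=
          mul_le_mul_of_nonneg_left hn (hnh n)
      _ = _ := by ring
  · set A : ℝ := (x - mpA c)⁻¹ ^ 2 + (mpB c - x)⁻¹ ^ 2
    have hApos : 0 < A := by
      have := sub_pos.2 hx.1
      have := sub_pos.2 hx.2
      positivity
    obtain ⟨M, hM, hle⟩ := exists_forall_le_mul_of_eventually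
      (u := fun n : ℕ => |(n : ℝ) * h n * (I n - f n) - (n : ℝ) * h n * (f n * J n - f n)|)
      (v := fun n : ℕ => 4 * n * h n ^ 3 * A * κ) (C := (C + B * (δ ^ 2)⁻¹) / (4 * A))
      (fun n => by have := (hhpos n).le; positivity)
      (fun n hn => by
        have hn0 : (n : ℝ) = 0 := by
          simpa [hApos.ne', hκpos.ne', (hhpos n).ne'] using hn
        simp [hn0])
      (by
        filter_upwards [hIf, hp.eventually hCB] with n hn hCBn
        have hB : |f n| ≤ B := hCBn.1
        have h₁ : |I n - f n * J n| ≤ C * h n ^ 2 * κ + B * ((δ ^ 2)⁻¹ * h n ^ 2 * κ) := by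
          have h₂ : I n - f n * J n = (I n - f n) - f n * (J n - 1) := by ring
          rw [h₂]
          refine (abs_sub _ _).trans (add_le_add hn ?_)
          rw [abs_mul]
          exact mul_le_mul hB (hJ1 n) (abs_nonneg _) ((abs_nonneg _).trans hB)
        calc |(n : ℝ) * h n * (I n - f n) - (n : ℝ) * h n * (f n * J n - f n)|
            = (n : ℝ) * h n * |I n - f n * J n| := by
              rw [← mul_sub, sub_sub_sub_cancel_right, abs_mul, abs_of_nonneg (hnh n)]
          _ ≤ (n : ℝ) * h n * (C * h n ^ 2 * κ + B * ((δ ^ 2)⁻¹ * h n ^ 2 * κ)) :=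
              mul_le_mul_of_nonneg_left h₁ (hnh n)
          _ = (C + B * (δ ^ 2)⁻¹) / (4 * A) * (4 * n * h n ^ 3 * A * κ) := by
              field_simp)
    refine ⟨M, hM, fun n => (hle n).trans ?_⟩
    have hsup : 0 ≤ ⨆ y : ℝ, mpDensity ((p n : ℝ) / n) y := by
      refine Real.iSup_nonneg fun y => ?_
      unfold mpDensity
      split_ifs with hy
      · have : 0 ≤ y := (sq_nonneg _).trans hy.1
        positivity
      · exact le_rfl
    have hv : 0 ≤ 4 * n * h n ^ 3 * A * κ := by have := (hhpos n).le; positivity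
    calc M * (4 * n * h n ^ 3 * A * κ)
        ≤ ((⨆ y : ℝ, mpDensity ((p n : ℝ) / n) y) + M) * (4 * n * h n ^ 3 * A * κ) :=
          mul_le_mul_of_nonneg_right (by linarith) hv
      _ = _ := by ring
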